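/- Let H be a separable complex Hilbert space, let A and B be Hilbert–Schmidt operators on H, and let (e_i) be a frame of H. Then the series ∑_{i=1}^∞ ⟨e_i, B A e_i⟩ converges, and its sum equals ∑_{i=1}^∞ ⟨f_i, B A f_i⟩ for every orthonormal basis (f_i) of H; that is, the trace of the trace-class operator BA can be computed using any frame in place of an orthonormal basis. -/

import Mathlib

open ContinuousLinearMap Filter Topology

noncomputable section

variable {H : Type*} [NormedAddCommGroup H] [InnerProductSpace ℂ H] [CompleteSpace H]
  [TopologicalSpace.SeparableSpace H]

local notation "⟪" x ", " y "⟫" => @inner ℂ _ _ x y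

/-- A frame of a Hilbert space: `⟨v,w⟩ = ∑ᵢ ⟨v,eᵢ⟩⟨eᵢ,w⟩` for all `v, w`. -/
def IsFrame (e : ℕ → H) : Prop :=
  ∀ v w : H, HasSum (fun i => ⟪v, e i⟫ * ⟪e i, w⟫) ⟪v, w⟫

/-- A bounded operator is Hilbert–Schmidt if `∑ᵢ ‖T fᵢ‖²` converges for every
orthonormal basis `f`. -/
def IsHilbertSchmidt (T : H →L[ℂ] H) : Prop :=
  ∀ f : HilbertBasis ℕ ℂ H, Summable fun i => ‖T (f i)‖ ^ 2

section ParsevalFamily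

variable {E : Type*} [NormedAddCommGroup E] [InnerProductSpace ℂ E]

/-- A family indexed by an arbitrary type satisfying the frame identity. -/
def IsParsevalFamily {κ : Type*} (e : κ → E) : Prop :=
  ∀ v w : E, HasSum (fun i => ⟪v, e i⟫ * ⟪e i, w⟫) ⟪v, w⟫

theorem HilbertBasis.isParsevalFamily {ι : Type*} (f : HilbertBasis ι ℂ E) :
    IsParsevalFamily (fun i => (f i : E)) :=
  fun v w => f.hasSum_inner_mul_inner v w

theorem IsParsevalFamily.hasSum_norm_inner_sq {κ : Type*} {e : κ → E}
    (he : IsParsevalFamily e) (v : E) :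
    HasSum (fun i => ‖⟪v, e i⟫‖ ^ 2) (‖v‖ ^ 2) := by
  have h := he v v
  rw [← Complex.hasSum_ofReal]
  convert h using 1
  · funext i
    rw [← inner_conj_symm (e i) v, RCLike.mul_conj]
    simp
  · rw [inner_self_eq_norm_sq_to_K]
    simp

/-- The matrix coefficients of a Hilbert–Schmidt operator with respect to an orthonormal basis
and a Parseval family are square summable. -/
theorem IsParsevalFamily.summable_norm_inner_apply_sq {ι κ : Type*} {e : κ → E}
    (he : IsParsevalFamily e) (f : ι → E) (T : E →L[ℂ] E)
    (hT : Summable fun j => ‖T (f j)‖ ^ 2) :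
    Summable fun p : ι × κ => ‖⟪T (f p.1), e p.2⟫‖ ^ 2 := by
  rw [summable_prod_of_nonneg (fun p => by positivity)]
  refine ⟨fun j => (he.hasSum_norm_inner_sq (T (f j))).summable, ?_⟩
  simpa only [(he.hasSum_norm_inner_sq (T (f _))).tsum_eq] using hT

variable [CompleteSpace E]

theorem IsParsevalFamily.summable_norm_adjoint_sq {ι κ : Type*} {e : κ → E}
    (he : IsParsevalFamily e) {f : ι → E} (hf : IsParsevalFamily f) (T : E →L[ℂ] E)
    (hT : Summable fun j => ‖T (f j)‖ ^ 2) :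
    Summable fun i => ‖adjoint T (e i)‖ ^ 2 := by
  have h := (he.summable_norm_inner_apply_sq f T hT).prod_symm.prod
  refine h.congr fun i => ?_
  rw [← (hf.hasSum_norm_inner_sq (adjoint T (e i))).tsum_eq]
  refine tsum_congr fun j => ?_
  simp only [Prod.swap_prod_mk]
  rw [adjoint_inner_left, norm_inner_symm]

theorem IsParsevalFamily.summable_norm_sq {ι κ : Type*} {e : κ → E}
    (he : IsParsevalFamily e) {f : ι → E} (hf : IsParsevalFamily f) (T : E →L[ℂ] E)
    (hT : Summable fun j => ‖T (f j)‖ ^ 2) :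
    Summable fun i => ‖T (e i)‖ ^ 2 := by
  simpa using he.summable_norm_adjoint_sq hf (adjoint T) (hf.summable_norm_adjoint_sq hf T hT)

theorem IsParsevalFamily.summable_inner_comp {ι κ : Type*} {e : κ → E}
    (he : IsParsevalFamily e) {f : ι → E} (hf : IsParsevalFamily f) (A B : E →L[ℂ] E)
    (hA : Summable fun j => ‖A (f j)‖ ^ 2) (hB : Summable fun j => ‖B (f j)‖ ^ 2) :
    Summable fun i => ⟪e i, B (A (e i))⟫ := by
  refine Summable.of_norm_bounded
    ((he.summable_norm_adjoint_sq hf B hB).add (he.summable_norm_sq hf A hA)) fun i => ?_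
  rw [← adjoint_inner_left]
  have h := norm_inner_le_norm (𝕜 := ℂ) (adjoint B (e i)) (A (e i))
  nlinarith [sq_nonneg (‖adjoint B (e i)‖ - ‖A (e i)‖), sq_nonneg ‖adjoint B (e i)‖,
    sq_nonneg ‖A (e i)‖]

/-- Cyclicity of the trace, computed in two Parseval families. -/
theorem IsParsevalFamily.tsum_inner_comp_comm {ι κ : Type*} {e : κ → E}
    (he : IsParsevalFamily e) {f : ι → E} (hf : IsParsevalFamily f) (A B : E →L[ℂ] E)
    (hA : Summable fun j => ‖A (f j)‖ ^ 2) (hB : Summable fun j => ‖B (f j)‖ ^ 2) :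
    ∑' i, ⟪e i, B (A (e i))⟫ = ∑' j, ⟪f j, A (B (f j))⟫ := by
  have hsum : Summable fun p : ι × κ =>
      ⟪adjoint A (f p.1), e p.2⟫ * ⟪e p.2, B (f p.1)⟫ := by
    refine Summable.of_norm_bounded
      ((he.summable_norm_inner_apply_sq f _ (hf.summable_norm_adjoint_sq hf A hA)).add
        (he.summable_norm_inner_apply_sq f B hB)) fun p => ?_
    rw [norm_mul, norm_inner_symm (e p.2)]
    set x := ‖⟪adjoint A (f p.1), e p.2⟫‖
    set y := ‖⟪B (f p.1), e p.2⟫‖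
    nlinarith [sq_nonneg (x - y), sq_nonneg x, sq_nonneg y]
  have hcomm := Summable.tsum_comm (f := fun j i =>
    ⟪adjoint A (f j), e i⟫ * ⟪e i, B (f j)⟫) hsum
  calc ∑' i, ⟪e i, B (A (e i))⟫
      = ∑' i, ∑' j, ⟪adjoint A (f j), e i⟫ * ⟪e i, B (f j)⟫ := tsum_congr fun i => by
        rw [← adjoint_inner_left, ← (hf (adjoint B (e i)) (A (e i))).tsum_eq]
        refine tsum_congr fun j => ?_
        rw [adjoint_inner_left, adjoint_inner_left, mul_comm]
    _ = ∑' j, ∑' i, ⟪adjoint A (f j), e i⟫ * ⟪e i, B (f j)⟫ := hcomm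
    _ = ∑' j, ⟪f j, A (B (f j))⟫ := tsum_congr fun j => by
        rw [(he (adjoint A (f j)) (B (f j))).tsum_eq, adjoint_inner_left]

end ParsevalFamily

theorem Orthonormal.countable_index {E : Type*} [NormedAddCommGroup E] [InnerProductSpace ℂ E]
    [TopologicalSpace.SeparableSpace E] {ι : Type*} {f : ι → E} (hf : Orthonormal ℂ f) :
    Countable ι := by
  refine Pairwise.countable_of_isOpen_disjoint (s := fun i => Metric.ball (f i) (1 / 2))
    (fun i j hij => ?_) (fun i => Metric.isOpen_ball) (fun i => ⟨f i, by simp⟩)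
  refine Metric.ball_disjoint_ball ?_
  have h : ‖f i - f j‖ * ‖f i - f j‖ = 2 := by
    rw [@norm_sub_mul_self ℂ, hf.2 hij, hf.1 i, hf.1 j]
    norm_num
  rw [dist_eq_norm]
  nlinarith [norm_nonneg (f i - f j)]

/-- A separable Hilbert space has an orthonormal basis which is finite or indexed by `ℕ`. -/
theorem exists_hilbertBasis_finite_or_nat (E : Type*) [NormedAddCommGroup E]
    [InnerProductSpace ℂ E] [CompleteSpace E] [TopologicalSpace.SeparableSpace E] :
    (∃ (s : Set E) (_ : HilbertBasis s ℂ E), Finite s) ∨ Nonempty (HilbertBasis ℕ ℂ E) := by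
  obtain ⟨s, b, -⟩ := exists_hilbertBasis ℂ E
  rcases finite_or_infinite s with h | h
  · exact Or.inl ⟨s, b, h⟩
  · have := b.orthonormal.countable_index
    obtain ⟨φ⟩ := nonempty_equiv_of_countable (α := ℕ) (β := s)
    refine Or.inr ⟨HilbertBasis.mk (b.orthonormal.comp φ φ.injective) ?_⟩
    rw [φ.surjective.range_comp, b.dense_span]

/-- for Hilbert–Schmidt operators `A`, `B` and a frame `e`, the series
`∑ᵢ ⟨eᵢ, BA eᵢ⟩` converges, and the sum equals `∑ᵢ ⟨fᵢ, BA fᵢ⟩` for every orthonormal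
basis `f`; i.e. the trace of the trace-class operator `BA` can be computed in any frame. -/
theorem frame_trace_of_product_of_hilbertSchmidt (A B : H →L[ℂ] H)
    (hA : IsHilbertSchmidt A) (hB : IsHilbertSchmidt B)
    (e : ℕ → H) (he : IsFrame e) :
    Summable (fun i => ⟪e i, B (A (e i))⟫) ∧
    ∀ f : HilbertBasis ℕ ℂ H,
      ∑' i, ⟪e i, B (A (e i))⟫ = ∑' i, ⟪(f i : H), B (A (f i))⟫ := by
  have he' : IsParsevalFamily e := he
  refine ⟨?_, fun f => ?_⟩
  · rcases exists_hilbertBasis_finite_or_nat H with ⟨s, b, hs⟩ | ⟨⟨f⟩⟩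
    · exact he'.summable_inner_comp b.isParsevalFamily A B Summable.of_finite Summable.of_finite
    · exact he'.summable_inner_comp f.isParsevalFamily A B (hA f) (hB f)
  · have hf := f.isParsevalFamily
    rw [he'.tsum_inner_comp_comm hf A B (hA f) (hB f),
      hf.tsum_inner_comp_comm hf A B (hA f) (hB f)]

end
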